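/- Let 0 < r < 1 and let T be an invertible bounded operator on a complex Hilbert space H. Then T belongs to C_{1,r} if and only if the operator (1+r²)·I − T*T − r²·T⁻¹T⁻* is positive (i.e. (1+r²)‖x‖² − ‖Tx‖² − r²‖T⁻*x‖² ≥ 0 for all x ∈ H). -/

import Mathlib

open ContinuousLinearMap

variable {H : Type*} [NormedAddCommGroup H] [InnerProductSpace ℂ H] [CompleteSpace H]

/-- `T ∈ C_{1,r}`: `T` is invertible, `‖T‖ ≤ 1` and `‖r • T⁻¹‖ ≤ 1`. -/
def MemC1r (r : ℝ) (T : H →L[ℂ] H) : Prop :=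
  IsUnit T ∧ ‖T‖ ≤ 1 ∧ ‖(r : ℂ) • Ring.inverse T‖ ≤ 1

/-- `T ∈ QA_r`: `T` is invertible, `‖r • T‖ ≤ 1` and `‖r • T⁻¹‖ ≤ 1`. -/
def MemQA (r : ℝ) (T : H →L[ℂ] H) : Prop :=
  IsUnit T ∧ ‖(r : ℂ) • T‖ ≤ 1 ∧ ‖(r : ℂ) • Ring.inverse T‖ ≤ 1

theorem le_of_sq_le_sq_aux {a b : ℝ} (h : a ^ 2 ≤ b ^ 2) (hb : 0 ≤ b) : a ≤ b :=
  (le_abs_self a).trans (abs_le_of_sq_le_sq h hb)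

theorem stmt2 (r : ℝ) (hr0 : 0 < r) (hr1 : r < 1) (T : H →L[ℂ] H) (hT : IsUnit T) :
    MemC1r r T ↔
      ∀ x : H, 0 ≤ (1 + r ^ 2) * ‖x‖ ^ 2 - ‖T x‖ ^ 2 -
        r ^ 2 * ‖adjoint (Ring.inverse T) x‖ ^ 2 := by
  obtain ⟨h1, h2⟩ : T * Ring.inverse T = 1 ∧ Ring.inverse T * T = 1 :=
    ⟨Ring.mul_inverse_cancel T hT, Ring.inverse_mul_cancel T hT⟩
  unfold MemC1r
  generalize Ring.inverse T = S at *
  have e1 : ∀ w, adjoint S (adjoint T w) = w := fun w => by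
    have := congrArg (fun A => star A) h1
    simp only [star_mul, star_one, star_eq_adjoint] at this
    exact congrArg (fun A : H →L[ℂ] H => A w) this
  have e2 : ∀ w, adjoint T (adjoint S w) = w := fun w => by
    have := congrArg (fun A => star A) h2
    simp only [star_mul, star_one, star_eq_adjoint] at this
    exact congrArg (fun A : H →L[ℂ] H => A w) this
  have nT : ‖adjoint T‖ = ‖T‖ := LinearIsometryEquiv.norm_map _ T
  have nS : ‖adjoint S‖ = ‖S‖ := LinearIsometryEquiv.norm_map _ S
  have nr : ‖(r : ℂ) • S‖ = r * ‖S‖ := by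
    rw [norm_smul, Complex.norm_real, Real.norm_of_nonneg hr0.le]
  have hc : 0 < 1 - r ^ 2 := by nlinarith
  have adj : ∀ a b : H, (inner ℂ (T a) b).re = (inner ℂ a (adjoint T b)).re := fun a b => by
    rw [adjoint_inner_right]
  have self : ∀ a : H, (inner ℂ a a).re = ‖a‖ ^ 2 := fun a => by
    rw [inner_self_eq_norm_sq_to_K]; norm_cast
  have expand : ∀ (a b : H) (s t : ℝ), ‖(s : ℂ) • a - (t : ℂ) • b‖ ^ 2 =
      s ^ 2 * ‖a‖ ^ 2 - 2 * s * t * (inner ℂ a b).re + t ^ 2 * ‖b‖ ^ 2 := fun a b s t => by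
    rw [@norm_sub_sq ℂ, inner_smul_left, inner_smul_right, norm_smul, norm_smul,
      Complex.norm_real, Complex.norm_real, mul_pow, mul_pow, Real.norm_eq_abs, Real.norm_eq_abs,
      sq_abs, sq_abs]
    simp
    ring
  rw [nr]
  constructor
  · rintro ⟨-, hT1, hS1⟩ x
    obtain ⟨w, rfl⟩ : ∃ w, x = adjoint T w := ⟨_, (e2 x).symm⟩
    rw [e1]
    have up : ∀ q, ‖adjoint T q‖ ^ 2 ≤ ‖q‖ ^ 2 := fun q => by
      have := (adjoint T).le_of_opNorm_le (nT.trans_le hT1) q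
      rw [one_mul] at this
      gcongr
    have lo : ∀ p, r ^ 2 * ‖p‖ ^ 2 ≤ ‖adjoint T p‖ ^ 2 := fun p => by
      have := (adjoint S).le_opNorm (adjoint T p)
      rw [e1, nS] at this
      have h3 : r * ‖p‖ ≤ ‖adjoint T p‖ := by
        calc r * ‖p‖ ≤ r * (‖S‖ * ‖adjoint T p‖) := by gcongr
          _ = (r * ‖S‖) * ‖adjoint T p‖ := by ring
          _ ≤ 1 * ‖adjoint T p‖ := by gcongr
          _ = _ := one_mul _
      rw [← mul_pow]
      gcongr
    have l := lo (((1 : ℝ) : ℂ) • w - ((1 : ℝ) : ℂ) • T (adjoint T w))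
    have k := up (((1 : ℝ) : ℂ) • T (adjoint T w) - ((r ^ 2 : ℝ) : ℂ) • w)
    rw [map_sub, map_smul, map_smul, expand, expand] at l k
    have i1 := adj (adjoint T w) (T (adjoint T w))
    have i2 := adj (adjoint T w) w
    have sy : ∀ a b : H, (inner ℂ a b).re = (inner ℂ b a).re := fun a b => inner_re_symm (𝕜 := ℂ) a b
    rw [self] at i1 i2
    rw [sy w, i2, ← i1] at l
    rw [i2, sy (adjoint T (T _)), ← i1] at k
    refine nonneg_of_mul_nonneg_right (a := 1 - r ^ 2) ?_ hc
    nlinarith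
  · intro h
    have key : ∀ w, r ^ 2 * ‖w‖ ^ 2 ≤ ‖adjoint T w‖ ^ 2 ∧ ‖adjoint T w‖ ^ 2 ≤ ‖w‖ ^ 2 := fun w => by
      have hw := h (adjoint T w)
      rw [e1] at hw
      have i2 := adj (adjoint T w) w
      rw [self] at i2
      have ex := expand (T (adjoint T w)) w 1 ((1 + r ^ 2) / 2)
      have b : ‖((1 : ℝ) : ℂ) • T (adjoint T w) - (((1 + r ^ 2) / 2 : ℝ) : ℂ) • w‖
          ≤ (1 - r ^ 2) / 2 * ‖w‖ := by
        refine le_of_sq_le_sq_aux ?_ (by positivity)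
        rw [ex, i2]
        nlinarith
      have cs := (Complex.abs_re_le_norm _).trans (norm_inner_le_norm (𝕜 := ℂ)
        (((1 : ℝ) : ℂ) • T (adjoint T w) - (((1 + r ^ 2) / 2 : ℝ) : ℂ) • w) w)
      have cs2 := cs.trans (mul_le_mul_of_nonneg_right b (norm_nonneg w))
      have ev : (inner ℂ (((1 : ℝ) : ℂ) • T (adjoint T w) - (((1 + r ^ 2) / 2 : ℝ) : ℂ) • w) w).re
          = ‖adjoint T w‖ ^ 2 - (1 + r ^ 2) / 2 * ‖w‖ ^ 2 := by
        rw [inner_sub_left, inner_smul_left, inner_smul_left, Complex.sub_re, Complex.conj_ofReal,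
          Complex.conj_ofReal, Complex.re_ofReal_mul, Complex.re_ofReal_mul, i2, self, one_mul]
      rw [ev, abs_le] at cs2
      constructor <;> nlinarith [cs2.1, cs2.2]
    refine ⟨hT, ?_, ?_⟩
    · rw [← nT]
      refine opNorm_le_bound _ zero_le_one fun w => ?_
      rw [one_mul]
      exact le_of_sq_le_sq_aux (key w).2 (norm_nonneg _)
    · rw [← nS, mul_comm, ← le_div_iff₀ hr0]
      refine opNorm_le_bound _ (by positivity) fun x => ?_
      have := (key (adjoint S x)).1
      rw [e2, ← mul_pow] at this
      have := le_of_sq_le_sq_aux this (norm_nonneg _)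
      rw [div_mul_eq_mul_div, one_mul, le_div_iff₀ hr0]
      linarith
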